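/- Let J ⊆ I and let v, w ∈ W with v ≤^J w. Then the interval [v,w] = {z ∈ W : v ≤^J z ≤^J w} of (W, ≤^J) is graded: it has minimum v and maximum w, a maximal chain from v to w exists, and every maximal chain from v to w has the same length, namely ℓ^J(w) − ℓ^J(v). -/

import Mathlib

/-!
Common definitions: Bruhat order, standard parabolic subgroups, minimal coset
representatives, the J-Bruhat (twisted) order and J-length, chains and
EL-labeling machinery, for a Coxeter system `cs : CoxeterSystem M W`.
-/

open scoped Classical

namespace TwistedTP

/-- A chain (list) realizing consecutive `r`-steps starting at `a` and ending at `b`. -/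
def IsChainFrom {α : Type*} (r : α → α → Prop) (c : List α) (a b : α) : Prop :=
  c.head? = some a ∧ c.getLast? = some b ∧ c.Chain' r

/-- The word of labels attached to the consecutive pairs of a list.
For a list `z₀ :: z₁ :: ⋯` (written from top to bottom in a descending chain),
the entries are `lab z₁ z₀, lab z₂ z₁, …`, i.e. `lab` is applied to each
covering pair `(lower, upper)`. -/
def labelWord {α Λ : Type*} (lab : α → α → Λ) : List α → List Λ
  | a :: b :: rest => lab b a :: labelWord lab (b :: rest)
  | _ => []

variable {B : Type*} {W : Type*} [Group W] {M : CoxeterMatrix B}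
variable (cs : CoxeterSystem M W)

/-- The (strong) Bruhat order on `W`: `v ≤ w` iff some reduced word for `w`
has a sublist whose product is `v`. -/
def bruhatLE (v w : W) : Prop :=
  ∃ ω : List B, cs.IsReduced ω ∧ cs.wordProd ω = w ∧
    ∃ ω' : List B, ω'.Sublist ω ∧ cs.wordProd ω' = v

def bruhatLT (v w : W) : Prop := bruhatLE cs v w ∧ v ≠ w

def bruhatCovBy (v w : W) : Prop :=
  bruhatLT cs v w ∧ ¬ ∃ z, bruhatLT cs v z ∧ bruhatLT cs z w

/-- The standard parabolic subgroup `W_J`. -/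
def parabolic (J : Set B) : Subgroup W := Subgroup.closure (cs.simple '' J)

lemma exists_minRep (J : Set B) (w : W) :
    ∃ u : W, u⁻¹ * w ∈ parabolic cs J ∧
      ∀ x : W, x⁻¹ * w ∈ parabolic cs J → cs.length u ≤ cs.length x := by
  have hne : (cs.length '' {x : W | x⁻¹ * w ∈ parabolic cs J}).Nonempty :=
    ⟨cs.length w, w, by simpa using (parabolic cs J).one_mem, rfl⟩
  obtain ⟨n, hn, hmin⟩ := Nat.lt_wfRel.wf.has_min _ hne
  obtain ⟨u, hu, rfl⟩ := hn
  refine ⟨u, hu, fun x hx => ?_⟩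
  by_contra h
  exact hmin _ ⟨x, hx, rfl⟩ (Nat.lt_of_not_le h)

/-- The minimal-length representative `w^J` of the coset `w W_J`. -/
noncomputable def minRep (J : Set B) (w : W) : W := (exists_minRep cs J w).choose

/-- The parabolic part `w_J = (w^J)⁻¹ w ∈ W_J` of `w`. -/
noncomputable def parPart (J : Set B) (w : W) : W := (minRep cs J w)⁻¹ * w

/-- The J-Bruhat (twisted) order `≤^J` on `W`:
`v ≤^J w` iff there is `u ∈ W_J` with `v^J u ≤ w^J` and `w_J ≤ u⁻¹ v_J`. -/
def twistedLE (J : Set B) (v w : W) : Prop :=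
  ∃ u ∈ parabolic cs J,
    bruhatLE cs (minRep cs J v * u) (minRep cs J w) ∧
    bruhatLE cs (parPart cs J w) (u⁻¹ * parPart cs J v)

def twistedLT (J : Set B) (v w : W) : Prop := twistedLE cs J v w ∧ v ≠ w

def twistedCovBy (J : Set B) (v w : W) : Prop :=
  twistedLT cs J v w ∧ ¬ ∃ z, twistedLT cs J v z ∧ twistedLT cs J z w

/-- The J-length `ℓ^J(w) = ℓ(w^J) - ℓ(w_J)` (an integer). -/
noncomputable def twistedLength (J : Set B) (w : W) : ℤ :=
  (cs.length (minRep cs J w) : ℤ) - (cs.length (parPart cs J w) : ℤ)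



/-! ### The strong exchange property -/

/-- The action of a simple reflection on pairs consisting of a group element and a sign: the element
is conjugated, and the sign flips exactly when the element is that reflection. -/
noncomputable def signedConj (i : B) : Function.End (W × ZMod 2) := fun p =>
  (cs.simple i * p.1 * cs.simple i, p.2 + if p.1 = cs.simple i then 1 else 0)

lemma signedConj_smul (i : B) (p : W × ZMod 2) :
    signedConj cs i • p =
      (cs.simple i * p.1 * cs.simple i, p.2 + if p.1 = cs.simple i then 1 else 0) :=
  rfl

lemma signedConj_mul_pow_smul (i j : B) (n : ℕ) (t : W) (ε : ZMod 2) :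
    ((signedConj cs i * signedConj cs j) ^ n) • (t, ε) =
      ((cs.simple i * cs.simple j) ^ n * t * ((cs.simple i * cs.simple j) ^ n)⁻¹,
        ε + ∑ k ∈ Finset.range (2 * n),
          if t = cs.simple j * (cs.simple i * cs.simple j) ^ k then 1 else 0) := by
  set c := cs.simple i * cs.simple j with hc
  have hsc : ∀ k : ℕ, (c ^ k)⁻¹ * cs.simple j = cs.simple j * c ^ k := by
    intro k
    induction k with
    | zero => simp
    | succ k ih =>
      rw [pow_succ', mul_inv_rev, hc, mul_inv_rev, cs.inv_simple, cs.inv_simple, ← hc]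
      calc (c ^ k)⁻¹ * (cs.simple j * cs.simple i) * cs.simple j
          = ((c ^ k)⁻¹ * cs.simple j) * c := by simp only [hc, mul_assoc]
        _ = cs.simple j * (c * c ^ k) := by rw [ih, mul_assoc, ← pow_succ, ← pow_succ']
  have hfirst : ∀ k : ℕ, c ^ k * t * (c ^ k)⁻¹ = cs.simple j ↔ t = cs.simple j * c ^ (2 * k) := by
    intro k
    rw [mul_inv_eq_iff_eq_mul, ← eq_inv_mul_iff_mul_eq, ← mul_assoc, hsc, mul_assoc, ← pow_add,
      two_mul]
  have hsecond : ∀ k : ℕ, cs.simple j * (c ^ k * t * (c ^ k)⁻¹) * cs.simple j = cs.simple i ↔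
      t = cs.simple j * c ^ (2 * k + 1) := by
    intro k
    have h1 : cs.simple j * (c ^ k * t * (c ^ k)⁻¹) * cs.simple j = cs.simple i ↔
        c ^ k * t * (c ^ k)⁻¹ = cs.simple j * c := by
      generalize c ^ k * t * (c ^ k)⁻¹ = x
      rw [hc]
      constructor
      · intro h
        rw [← h]
        simp [mul_assoc]
      · rintro rfl
        simp [mul_assoc]
    rw [h1, mul_inv_eq_iff_eq_mul, ← eq_inv_mul_iff_mul_eq, mul_assoc, ← mul_assoc, hsc,
      mul_assoc, ← pow_succ', ← pow_add]
    ring_nf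
  induction n with
  | zero => simp
  | succ n ih =>
    rw [pow_succ', mul_smul, ih, mul_smul]
    simp only [signedConj_smul, hfirst, hsecond]
    refine Prod.ext ?_ ?_
    · simp [pow_succ', hc, mul_assoc]
    · rw [show 2 * (n + 1) = 2 * n + 1 + 1 by ring, Finset.sum_range_succ, Finset.sum_range_succ]
      simp only [add_assoc]

lemma isLiftable_signedConj : M.IsLiftable (signedConj cs) := by
  intro i j
  funext ⟨t, ε⟩
  change ((signedConj cs i * signedConj cs j) ^ M i j) • (t, ε) = (t, ε)
  have h := cs.simple_mul_simple_pow i j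
  rw [signedConj_mul_pow_smul, h, two_mul, Finset.sum_range_add]
  simp only [pow_add, h, one_mul, mul_one, inv_one]
  rw [CharTwo.add_self_eq_zero, add_zero]

/-- The action of the Coxeter group on signed elements extending `signedConj`. -/
noncomputable def signedConjHom : W →* Function.End (W × ZMod 2) :=
  cs.lift ⟨signedConj cs, isLiftable_signedConj cs⟩

lemma signedConjHom_wordProd (ω : List B) (t : W) (ε : ZMod 2) :
    signedConjHom cs (cs.wordProd ω) • (t, ε) =
      (cs.wordProd ω * t * (cs.wordProd ω)⁻¹, ε + ((cs.rightInvSeq ω).count t : ℕ)) := by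
  induction ω with
  | nil => simp
  | cons i ω ih =>
    have hi : signedConjHom cs (cs.simple i) = signedConj cs i := cs.lift_apply_simple _ i
    rw [cs.wordProd_cons, map_mul, mul_smul, ih, hi]
    have h : cs.wordProd ω * t * (cs.wordProd ω)⁻¹ = cs.simple i ↔
        (cs.wordProd ω)⁻¹ * cs.simple i * cs.wordProd ω = t := by
      rw [mul_inv_eq_iff_eq_mul, ← eq_inv_mul_iff_mul_eq, eq_comm, mul_assoc]
    simp only [signedConj_smul, h, CoxeterSystem.rightInvSeq, List.count_cons, beq_iff_eq]
    refine Prod.ext ?_ ?_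
    · simp [mul_assoc]
    · push_cast
      simp only [add_assoc]

lemma signedConjHom_smul_fst (w t : W) (ε : ZMod 2) :
    (signedConjHom cs w • (t, ε)).1 = w * t * w⁻¹ := by
  obtain ⟨ω, -, rfl⟩ := cs.exists_isReduced w
  rw [signedConjHom_wordProd]

lemma signedConjHom_smul_add (w t : W) (ε δ : ZMod 2) :
    signedConjHom cs w • (t, ε + δ) =
      ((signedConjHom cs w • (t, ε)).1, (signedConjHom cs w • (t, ε)).2 + δ) := by
  obtain ⟨ω, -, rfl⟩ := cs.exists_isReduced w
  rw [signedConjHom_wordProd, signedConjHom_wordProd]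
  exact Prod.ext rfl (add_right_comm _ _ _)

lemma signedConjHom_reflection {t : W} (ht : cs.IsReflection t) :
    signedConjHom cs t • (t, (0 : ZMod 2)) = (t, 1) := by
  obtain ⟨g, i, rfl⟩ := ht
  have hi : signedConjHom cs (cs.simple i) = signedConj cs i := cs.lift_apply_simple _ i
  have hfst : (signedConjHom cs g⁻¹ • (g * cs.simple i * g⁻¹, (0 : ZMod 2))).1 = cs.simple i := by
    rw [signedConjHom_smul_fst]
    simp [mul_assoc]
  obtain ⟨δ, hδ⟩ : ∃ δ, signedConjHom cs g⁻¹ • (g * cs.simple i * g⁻¹, (0 : ZMod 2)) =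
      (cs.simple i, δ) :=
    ⟨_, Prod.ext hfst rfl⟩
  have hback : signedConjHom cs g • (cs.simple i, δ) = (g * cs.simple i * g⁻¹, (0 : ZMod 2)) := by
    rw [← hδ, ← mul_smul, ← map_mul]
    simp
  rw [map_mul, map_mul, mul_smul, hδ, mul_smul, hi]
  simp only [signedConj_smul, cs.simple_mul_simple_self, one_mul, if_true]
  rw [signedConjHom_smul_add, hback, zero_add]

lemma mem_rightInvSeq_of_length_lt {ω : List B} {t : W} (ht : cs.IsReflection t)
    (h : cs.length (cs.wordProd ω * t) < cs.length (cs.wordProd ω)) : t ∈ cs.rightInvSeq ω := by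
  by_contra hmem
  obtain ⟨ω', hred, hω'⟩ := cs.exists_isReduced (cs.wordProd ω * t)
  have hsign : signedConjHom cs (cs.wordProd ω * t) • (t, (0 : ZMod 2)) =
      ((signedConjHom cs (cs.wordProd ω) • (t, (0 : ZMod 2))).1, 1) := by
    rw [map_mul, mul_smul, signedConjHom_reflection cs ht,
      ← zero_add (1 : ZMod 2), signedConjHom_smul_add, signedConjHom_wordProd,
      List.count_eq_zero_of_not_mem hmem]
    simp
  have hmem' : t ∈ cs.rightInvSeq ω' := by
    by_contra hmem'
    rw [hω', signedConjHom_wordProd, List.count_eq_zero_of_not_mem hmem'] at hsign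
    simpa using congrArg Prod.snd hsign
  have hlt := (cs.isRightInversion_of_mem_rightInvSeq hred hmem').2
  rw [← hω', mul_assoc, ht.mul_self, mul_one] at hlt
  omega

/-- The strong exchange property, for words that need not be reduced. -/
lemma mem_leftInvSeq_of_length_lt {ω : List B} {t : W} (ht : cs.IsReflection t)
    (h : cs.length (t * cs.wordProd ω) < cs.length (cs.wordProd ω)) : t ∈ cs.leftInvSeq ω := by
  have hlt : cs.length (cs.wordProd ω.reverse * t) < cs.length (cs.wordProd ω.reverse) := by
    rw [cs.wordProd_reverse, cs.length_inv, ← cs.length_inv, mul_inv_rev, inv_inv, ht.inv]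
    exact h
  simpa [cs.rightInvSeq_reverse] using mem_rightInvSeq_of_length_lt cs ht hlt

lemma exists_eraseIdx_of_mem_leftInvSeq {ω : List B} {t : W} (h : t ∈ cs.leftInvSeq ω) :
    ∃ j < ω.length, t * cs.wordProd ω = cs.wordProd (ω.eraseIdx j) := by
  obtain ⟨j, hj, rfl⟩ := List.mem_iff_getElem.1 h
  refine ⟨j, by simpa using hj, ?_⟩
  rw [← cs.getD_leftInvSeq_mul_wordProd, List.getD_eq_getElem]

/-- Every word has a reduced subword with the same product. -/
lemma exists_reduced_sublist (ω : List B) :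
    ∃ τ : List B, τ.Sublist ω ∧ cs.IsReduced τ ∧ cs.wordProd τ = cs.wordProd ω := by
  induction ω with
  | nil => exact ⟨[], List.Sublist.refl _, by simp [CoxeterSystem.IsReduced], rfl⟩
  | cons i ω ih =>
    obtain ⟨τ, hsub, hred, hprod⟩ := ih
    rcases cs.length_simple_mul (cs.wordProd τ) i with h | h
    · refine ⟨i :: τ, hsub.cons_cons i, ?_, by rw [cs.wordProd_cons, cs.wordProd_cons, hprod]⟩
      rw [CoxeterSystem.IsReduced, cs.wordProd_cons, h, hred.eq, List.length_cons]
    · obtain ⟨j, hj, he⟩ := exists_eraseIdx_of_mem_leftInvSeq cs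
        (mem_leftInvSeq_of_length_lt cs (cs.isReflection_simple i) (ω := τ) (by omega))
      refine ⟨τ.eraseIdx j, ((List.eraseIdx_sublist τ j).trans hsub).cons i, ?_, by rw [← he, cs.wordProd_cons, hprod]⟩
      rw [CoxeterSystem.IsReduced, ← he, List.length_eraseIdx_of_lt hj, ← hred.eq]
      omega

/-! ### The Bruhat order -/

/-- Left multiplication by a reflection that increases the length. -/
def reflectionStep (v w : W) : Prop :=
  ∃ t, cs.IsReflection t ∧ w = t * v ∧ cs.length v < cs.length w

lemma exists_sublist_of_reflectionSteps {v : W} {ω : List B}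
    (h : Relation.ReflTransGen (reflectionStep cs) v (cs.wordProd ω)) :
    ∃ τ : List B, τ.Sublist ω ∧ cs.wordProd τ = v := by
  induction h using Relation.ReflTransGen.head_induction_on with
  | refl => exact ⟨ω, List.Sublist.refl _, rfl⟩
  | @head x _ h _ ih =>
    obtain ⟨τ, hτ, rfl⟩ := ih
    obtain ⟨t, ht, hv, hlt⟩ := h
    have hv' : t * cs.wordProd τ = x := by rw [hv, ← mul_assoc, ht.mul_self, one_mul]
    rw [← hv'] at hlt
    obtain ⟨j, -, he⟩ := exists_eraseIdx_of_mem_leftInvSeq cs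
      (mem_leftInvSeq_of_length_lt cs ht hlt)
    exact ⟨τ.eraseIdx j, (List.eraseIdx_sublist τ j).trans hτ, by rw [← he, hv']⟩

lemma reflectionStep_simple_mul {w : W} {i : B}
    (h : cs.length w < cs.length (cs.simple i * w)) : reflectionStep cs w (cs.simple i * w) :=
  ⟨cs.simple i, cs.isReflection_simple i, rfl, h⟩

lemma reflectionStep_of_length_simple_mul_lt {w : W} {i : B}
    (h : cs.length (cs.simple i * w) < cs.length w) : reflectionStep cs (cs.simple i * w) w :=
  ⟨cs.simple i, cs.isReflection_simple i, by simp, h⟩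

lemma reflectionStep.simple_mul {v w : W} (h : reflectionStep cs v w) (i : B) :
    Relation.ReflTransGen (reflectionStep cs) (cs.simple i * v) w ∨
      Relation.ReflTransGen (reflectionStep cs) (cs.simple i * v) (cs.simple i * w) := by
  have h' := h
  obtain ⟨t, ht, rfl, hlt⟩ := h
  by_cases hti : t = cs.simple i
  · subst hti
    exact Or.inl .refl
  rcases cs.length_simple_mul v i with hv | hv
  · right
    refine .single ⟨cs.simple i * t * (cs.simple i)⁻¹, ht.conj _, by simp [mul_assoc], ?_⟩
    have hne : cs.length (cs.simple i * (t * v)) ≠ cs.length (cs.simple i * v) := by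
      have := (ht.conj (cs.simple i)).length_mul_right_ne (cs.simple i * v)
      simpa [mul_assoc] using this
    by_contra hle
    obtain ⟨ω, hω, rfl⟩ := cs.exists_isReduced v
    have hmem : cs.simple i * t * (cs.simple i)⁻¹ ∈ cs.leftInvSeq (i :: ω) := by
      refine mem_leftInvSeq_of_length_lt cs (ht.conj _) ?_
      rw [cs.wordProd_cons]
      simp only [mul_assoc, inv_mul_cancel_left]
      omega
    rw [CoxeterSystem.leftInvSeq, List.mem_cons] at hmem
    rcases hmem with heq | hmem
    · apply hti
      simpa using eq_inv_of_mul_eq_one_left (a := t) (b := cs.simple i)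
        (by simpa [mul_assoc, mul_eq_left] using heq)
    · obtain ⟨r, hr, hrt⟩ := List.mem_map.1 hmem
      obtain rfl : r = t := (MulAut.conj (cs.simple i)).injective (by rw [hrt, MulAut.conj_apply])
      exact absurd hlt (not_lt.2 (cs.isLeftInversion_of_mem_leftInvSeq hω hr).2.le)
  · left
    exact .head (reflectionStep_of_length_simple_mul_lt cs (by omega)) (.single h')

lemma simple_mul_of_reflectionSteps {v w : W}
    (h : Relation.ReflTransGen (reflectionStep cs) v w) (i : B) :
    Relation.ReflTransGen (reflectionStep cs) (cs.simple i * v) w ∨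
      Relation.ReflTransGen (reflectionStep cs) (cs.simple i * v) (cs.simple i * w) := by
  induction h using Relation.ReflTransGen.head_induction_on with
  | refl => exact Or.inr .refl
  | head h hcw ih =>
    rcases h.simple_mul cs i with h1 | h1
    · exact Or.inl (h1.trans hcw)
    · exact ih.imp h1.trans h1.trans

lemma reflectionSteps_of_sublist {τ ω : List B} (hω : cs.IsReduced ω) (h : τ.Sublist ω) :
    Relation.ReflTransGen (reflectionStep cs) (cs.wordProd τ) (cs.wordProd ω) := by
  induction ω generalizing τ with
  | nil => rw [List.sublist_nil.1 h]
  | cons i ω ih =>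
    have hω' : cs.IsReduced ω := by simpa using hω.drop 1
    have hstep : reflectionStep cs (cs.wordProd ω) (cs.simple i * cs.wordProd ω) := by
      refine reflectionStep_simple_mul cs ?_
      rw [← cs.wordProd_cons, hω.eq, hω'.eq, List.length_cons]
      exact Nat.lt_succ_self _
    rw [cs.wordProd_cons]
    cases h with
    | cons _ h => exact (ih hω' h).tail hstep
    | cons_cons _ h =>
      rw [cs.wordProd_cons]
      exact (simple_mul_of_reflectionSteps cs (ih hω' h) i).elim (·.tail hstep) id

lemma bruhatLE_iff_reflectionSteps {v w : W} :
    bruhatLE cs v w ↔ Relation.ReflTransGen (reflectionStep cs) v w := by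
  constructor
  · rintro ⟨ω, hω, rfl, τ, hτ, rfl⟩
    exact reflectionSteps_of_sublist cs hω hτ
  · intro h
    obtain ⟨ω, hω, rfl⟩ := cs.exists_isReduced w
    exact ⟨ω, hω, rfl, exists_sublist_of_reflectionSteps cs h⟩

variable {cs}

lemma bruhatLE_wordProd {τ ω : List B} (hω : cs.IsReduced ω) (h : τ.Sublist ω) :
    bruhatLE cs (cs.wordProd τ) (cs.wordProd ω) :=
  ⟨ω, hω, rfl, τ, h, rfl⟩

/-- The subword property, for arbitrary words. -/
lemma bruhatLE.exists_sublist {v : W} {ω : List B} (h : bruhatLE cs v (cs.wordProd ω)) :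
    ∃ τ : List B, τ.Sublist ω ∧ cs.wordProd τ = v :=
  exists_sublist_of_reflectionSteps cs ((bruhatLE_iff_reflectionSteps cs).1 h)

lemma bruhatLE_refl (w : W) : bruhatLE cs w w :=
  (bruhatLE_iff_reflectionSteps cs).2 .refl

lemma bruhatLE.trans {u v w : W} (h : bruhatLE cs u v) (h' : bruhatLE cs v w) :
    bruhatLE cs u w := by
  rw [bruhatLE_iff_reflectionSteps] at *
  exact Relation.ReflTransGen.trans h h'

lemma bruhatLE.eq_or_length_lt {v w : W} (h : bruhatLE cs v w) :
    v = w ∨ cs.length v < cs.length w := by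
  rw [bruhatLE_iff_reflectionSteps] at h
  induction h with
  | refl => exact Or.inl rfl
  | tail _ h ih =>
    obtain ⟨_, _, _, hlt⟩ := h
    rcases ih with rfl | ih
    · exact Or.inr hlt
    · exact Or.inr (ih.trans hlt)

lemma bruhatLE.length_le {v w : W} (h : bruhatLE cs v w) : cs.length v ≤ cs.length w := by
  rcases h.eq_or_length_lt with rfl | h
  · exact le_rfl
  · exact h.le

lemma bruhatLE.eq_of_length_le {v w : W} (h : bruhatLE cs v w)
    (hl : cs.length w ≤ cs.length v) : v = w :=
  h.eq_or_length_lt.resolve_right hl.not_gt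

lemma bruhatLE.inv {v w : W} (h : bruhatLE cs v w) : bruhatLE cs v⁻¹ w⁻¹ := by
  obtain ⟨ω, hω, rfl, τ, hτ, rfl⟩ := h
  exact ⟨ω.reverse, hω.reverse, cs.wordProd_reverse ω, τ.reverse, List.reverse_sublist.2 hτ,
    cs.wordProd_reverse τ⟩

lemma bruhatLE_simple_mul {w : W} {i : B} (h : cs.length w < cs.length (cs.simple i * w)) :
    bruhatLE cs w (cs.simple i * w) :=
  (bruhatLE_iff_reflectionSteps cs).2 (.single (reflectionStep_simple_mul cs h))

lemma simple_mul_bruhatLE {w : W} {i : B} (h : cs.length (cs.simple i * w) < cs.length w) :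
    bruhatLE cs (cs.simple i * w) w :=
  (bruhatLE_iff_reflectionSteps cs).2 (.single (reflectionStep_of_length_simple_mul_lt cs h))

lemma bruhatLE.simple_mul_or {v w : W} (h : bruhatLE cs v w) (i : B) :
    bruhatLE cs (cs.simple i * v) w ∨ bruhatLE cs (cs.simple i * v) (cs.simple i * w) := by
  simp only [bruhatLE_iff_reflectionSteps] at *
  exact simple_mul_of_reflectionSteps cs h i

lemma bruhatLE.simple_mul_left {v w : W} {i : B} (h : bruhatLE cs v w)
    (hw : cs.length (cs.simple i * w) < cs.length w) : bruhatLE cs (cs.simple i * v) w :=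
  (h.simple_mul_or i).elim id (·.trans (simple_mul_bruhatLE hw))

lemma bruhatLE.simple_mul_both {v w : W} {i : B} (h : bruhatLE cs v w)
    (hw : cs.length w < cs.length (cs.simple i * w)) :
    bruhatLE cs (cs.simple i * v) (cs.simple i * w) :=
  (h.simple_mul_or i).elim (·.trans (bruhatLE_simple_mul hw)) id

lemma bruhatLE.le_or_simple_mul_le {v w : W} (h : bruhatLE cs v w) (i : B) :
    bruhatLE cs v (cs.simple i * w) ∨ bruhatLE cs (cs.simple i * v) (cs.simple i * w) := by
  obtain ⟨ω, hω, hωw⟩ := cs.exists_isReduced (cs.simple i * w)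
  rw [show w = cs.wordProd (i :: ω) by rw [cs.wordProd_cons, ← hωw]; simp] at h
  obtain ⟨τ, hτ, rfl⟩ := h.exists_sublist
  rw [hωw]
  cases hτ with
  | cons _ hτ => exact Or.inl (bruhatLE_wordProd hω hτ)
  | cons_cons _ hτ =>
    right
    rw [cs.wordProd_cons, cs.simple_mul_simple_cancel_left]
    exact bruhatLE_wordProd hω hτ

/-- The lifting property. -/
lemma bruhatLE.le_simple_mul {v w : W} {i : B} (h : bruhatLE cs v w)
    (hv : cs.length v < cs.length (cs.simple i * v)) : bruhatLE cs v (cs.simple i * w) :=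
  (h.le_or_simple_mul_le i).elim id (bruhatLE_simple_mul hv).trans

lemma bruhatLE.simple_mul_le_simple_mul {v w : W} {i : B} (h : bruhatLE cs v w)
    (hv : cs.length (cs.simple i * v) < cs.length v) :
    bruhatLE cs (cs.simple i * v) (cs.simple i * w) :=
  (h.le_or_simple_mul_le i).elim (simple_mul_bruhatLE hv).trans id

/-- A proper Bruhat relation factors through an element of length one less than the top. -/
lemma bruhatLE.exists_coatom {v w : W} (h : bruhatLE cs v w) (hne : v ≠ w) :
    ∃ w', bruhatLE cs v w' ∧ bruhatLE cs w' w ∧ cs.length w' + 1 = cs.length w := by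
  induction hn : cs.length w generalizing v w with
  | zero =>
    have := h.eq_or_length_lt.resolve_left hne
    omega
  | succ n ih =>
    obtain ⟨i, hi⟩ := cs.exists_leftDescent_of_ne_one (w := w) (by rintro rfl; simp at hn)
    have hi' : cs.length (cs.simple i * w) + 1 = cs.length w := cs.isLeftDescent_iff.1 hi
    rcases cs.length_simple_mul v i with hv | hv
    · exact ⟨_, h.le_simple_mul (i := i) (by omega), simple_mul_bruhatLE hi, by omega⟩
    obtain ⟨x, hvx, hxw, hx⟩ := ih (h.simple_mul_le_simple_mul (i := i) (by omega))
      (fun he => hne (mul_left_cancel he)) (by omega)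
    rcases cs.length_simple_mul x i with hsx | hsx
    · refine ⟨cs.simple i * x, ?_, ?_, by omega⟩
      · simpa using hvx.simple_mul_both (i := i) (by omega)
      · simpa using hxw.simple_mul_both (i := i) 
          (by simp only [cs.simple_mul_simple_cancel_left]; omega)
    · refine ⟨cs.simple i * w, ?_, simple_mul_bruhatLE hi, by omega⟩
      refine bruhatLE.trans ?_ hxw
      simpa using hvx.simple_mul_left (i := i) (by omega)

/-- Left multiplication by `c` respects the Bruhat order up to shrinking `c` on the larger side. -/
lemma bruhatLE.exists_mul_le_mul {a a' : W} (h : bruhatLE cs a' a) (c : W) :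
    ∃ d, bruhatLE cs d c ∧ bruhatLE cs (c * a') (d * a) := by
  obtain ⟨ω, hω, rfl⟩ := cs.exists_isReduced c
  induction ω with
  | nil => exact ⟨1, by simp [bruhatLE_refl], by simpa using h⟩
  | cons i ω ih =>
    have hω' : cs.IsReduced ω := by simpa using hω.drop 1
    obtain ⟨d, hd, hda⟩ := ih hω'
    have hlt : cs.length (cs.wordProd ω) < cs.length (cs.simple i * cs.wordProd ω) := by
      rw [← cs.wordProd_cons, hω.eq, hω'.eq, List.length_cons]
      exact Nat.lt_succ_self _
    rw [cs.wordProd_cons]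
    rcases hda.simple_mul_or i with h1 | h1
    · exact ⟨d, hd.trans (bruhatLE_simple_mul hlt), by rwa [mul_assoc]⟩
    · exact ⟨cs.simple i * d, hd.simple_mul_both hlt, by rwa [mul_assoc, mul_assoc]⟩

/-! ### Minimal coset representatives -/

variable {J : Set B}

/-- `x` has minimal length in its coset `x W_J`. -/
def IsMinRep (cs : CoxeterSystem M W) (J : Set B) (x : W) : Prop :=
  ∀ u ∈ parabolic cs J, cs.length x ≤ cs.length (x * u)

lemma wordProd_mem_parabolic {ω : List B} (h : ∀ i ∈ ω, i ∈ J) :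
    cs.wordProd ω ∈ parabolic cs J := by
  induction ω with
  | nil => simp
  | cons i ω ih =>
    rw [cs.wordProd_cons]
    exact mul_mem (Subgroup.subset_closure ⟨i, h i (by simp), rfl⟩)
      (ih fun j hj => h j (by simp [hj]))

lemma exists_isReduced_of_mem_parabolic {u : W} (h : u ∈ parabolic cs J) :
    ∃ ω : List B, cs.IsReduced ω ∧ (∀ i ∈ ω, i ∈ J) ∧ cs.wordProd ω = u := by
  suffices ∃ ω : List B, (∀ i ∈ ω, i ∈ J) ∧ cs.wordProd ω = u by
    obtain ⟨ω, hJ, rfl⟩ := this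
    obtain ⟨τ, hτ, hred, he⟩ := exists_reduced_sublist cs ω
    exact ⟨τ, hred, fun i hi => hJ i (hτ.subset hi), he⟩
  induction h using Subgroup.closure_induction with
  | mem x hx =>
    obtain ⟨i, hi, rfl⟩ := hx
    exact ⟨[i], by simpa using hi, by simp⟩
  | one => exact ⟨[], by simp, by simp⟩
  | mul x y _ _ hx hy =>
    obtain ⟨ω, hω, rfl⟩ := hx
    obtain ⟨ω', hω', rfl⟩ := hy
    refine ⟨ω ++ ω', fun i hi => ?_, cs.wordProd_append ω ω'⟩
    exact (List.mem_append.1 hi).elim (hω i) (hω' i)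
  | inv x _ hx =>
    obtain ⟨ω, hω, rfl⟩ := hx
    exact ⟨ω.reverse, fun i hi => hω i (List.mem_reverse.1 hi), cs.wordProd_reverse ω⟩

lemma bruhatLE.mem_parabolic {u u' : W} (h : bruhatLE cs u' u) (hu : u ∈ parabolic cs J) :
    u' ∈ parabolic cs J := by
  obtain ⟨ω, -, hJ, rfl⟩ := exists_isReduced_of_mem_parabolic hu
  obtain ⟨τ, hτ, rfl⟩ := h.exists_sublist
  exact wordProd_mem_parabolic fun i hi => hJ i (hτ.subset hi)

lemma IsMinRep.length_mul {x u : W} (hx : IsMinRep cs J x) (hu : u ∈ parabolic cs J) :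
    cs.length (x * u) = cs.length x + cs.length u := by
  refine le_antisymm (cs.length_mul_le x u) ?_
  obtain ⟨ω, hω, rfl⟩ := cs.exists_isReduced x
  obtain ⟨ω', hω', hJ, rfl⟩ := exists_isReduced_of_mem_parabolic hu
  obtain ⟨τ, hτ, hred, he⟩ := exists_reduced_sublist cs (ω ++ ω')
  obtain ⟨τ₁, τ₂, rfl, h₁, h₂⟩ := List.sublist_append_iff.1 hτ
  have hτ₂ : cs.wordProd τ₂ ∈ parabolic cs J :=
    wordProd_mem_parabolic fun i hi => hJ i (h₂.subset hi)
  rw [cs.wordProd_append, cs.wordProd_append] at he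
  have hmin := hx _ (mul_mem hu (inv_mem hτ₂))
  rw [← mul_assoc, ← he, mul_inv_cancel_right, hω.eq] at hmin
  obtain rfl := h₁.eq_of_length_le (hmin.trans (cs.length_wordProd_le τ₁))
  have hlen := cs.length_wordProd_le τ₂
  rw [mul_left_cancel he] at hlen
  rw [← he, ← cs.wordProd_append, hred.eq, List.length_append, hω.eq]
  exact Nat.add_le_add_left hlen _

lemma IsMinRep.eq_one_of_mul {x u : W} (hx : IsMinRep cs J x) (hxu : IsMinRep cs J (x * u))
    (hu : u ∈ parabolic cs J) : u = 1 := by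
  have h := hxu _ (inv_mem hu)
  rw [mul_inv_cancel_right, hx.length_mul hu] at h
  exact cs.length_eq_zero_iff.1 (by omega)

lemma IsMinRep.mul_bruhatLE_mul {x u u' : W} (hx : IsMinRep cs J x) (hu : u ∈ parabolic cs J)
    (h : bruhatLE cs u' u) : bruhatLE cs (x * u') (x * u) := by
  have hlen := hx.length_mul hu
  obtain ⟨ω, hω, rfl⟩ := cs.exists_isReduced x
  obtain ⟨ω', hω', rfl⟩ := cs.exists_isReduced u
  obtain ⟨τ, hτ, rfl⟩ := h.exists_sublist
  rw [← cs.wordProd_append, ← cs.wordProd_append]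
  refine bruhatLE_wordProd ?_ ((List.Sublist.refl ω).append hτ)
  rw [CoxeterSystem.IsReduced, cs.wordProd_append, hlen, List.length_append, hω.eq, hω'.eq]

lemma IsMinRep.simple_mul {x : W} {i : B} (hx : IsMinRep cs J x)
    (hi : cs.length (cs.simple i * x) < cs.length x) : IsMinRep cs J (cs.simple i * x) := by
  intro u hu
  have h := hx u hu
  rw [mul_assoc]
  have := cs.length_simple_mul x i
  have := cs.length_simple_mul (x * u) i
  omega

lemma isMinRep_minRep (w : W) : IsMinRep cs J (minRep cs J w) := by
  intro u hu
  obtain ⟨hmem, hmin⟩ := (exists_minRep cs J w).choose_spec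
  refine hmin _ ?_
  rw [mul_inv_rev, mul_assoc]
  exact mul_mem (inv_mem hu) hmem

lemma parPart_mem (w : W) : parPart cs J w ∈ parabolic cs J :=
  (exists_minRep cs J w).choose_spec.1

lemma minRep_mul_parPart (w : W) : minRep cs J w * parPart cs J w = w :=
  mul_inv_cancel_left _ _

lemma IsMinRep.minRep_mul {x a : W} (hx : IsMinRep cs J x) (ha : a ∈ parabolic cs J) :
    minRep cs J (x * a) = x := by
  have he := minRep_mul_parPart (cs := cs) (J := J) (x * a)
  have hm := isMinRep_minRep (cs := cs) (J := J) (x * a)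
  have hp := parPart_mem (cs := cs) (J := J) (x * a)
  have hx' : x * (a * (parPart cs J (x * a))⁻¹) = minRep cs J (x * a) := by
    rw [← mul_assoc, mul_inv_eq_iff_eq_mul, he]
  have h1 := hx.eq_one_of_mul (by rwa [hx']) (mul_mem ha (inv_mem hp))
  rw [← hx', h1, mul_one]

lemma IsMinRep.parPart_mul {x a : W} (hx : IsMinRep cs J x) (ha : a ∈ parabolic cs J) :
    parPart cs J (x * a) = a := by
  rw [parPart, hx.minRep_mul ha, inv_mul_cancel_left]

/-- Below a minimal coset representative, one can go up by one in length while changing coset. -/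
lemma IsMinRep.exists_atom {g y : W} (hy : IsMinRep cs J y) (h : bruhatLE cs g y) (hne : g ≠ y) :
    ∃ y', bruhatLE cs g y' ∧ bruhatLE cs y' y ∧ cs.length y' = cs.length g + 1 ∧
      g⁻¹ * y' ∉ parabolic cs J := by
  induction hn : cs.length y generalizing g y with
  | zero =>
    have := h.eq_or_length_lt.resolve_left hne
    omega
  | succ n ih =>
    obtain ⟨i, hi⟩ := cs.exists_leftDescent_of_ne_one (w := y) (by rintro rfl; simp at hn)
    have hi' : cs.length (cs.simple i * y) + 1 = cs.length y := cs.isLeftDescent_iff.1 hi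
    have below : bruhatLE cs g (cs.simple i * y) → ∃ y', bruhatLE cs g y' ∧ bruhatLE cs y' y ∧
        cs.length y' = cs.length g + 1 ∧ g⁻¹ * y' ∉ parabolic cs J := by
      intro hg
      by_cases hgy : g = cs.simple i * y
      · refine ⟨y, h, bruhatLE_refl y, by rw [hgy, hi'], fun hmem => ?_⟩
        have := hy _ (inv_mem hmem)
        rw [mul_inv_rev, inv_inv, mul_inv_cancel_left, hgy] at this
        omega
      · obtain ⟨y', h1, h2, h3, h4⟩ := ih (hy.simple_mul hi) hg hgy (by omega)
        exact ⟨y', h1, h2.trans (simple_mul_bruhatLE hi), h3, h4⟩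
    rcases cs.length_simple_mul g i with hg | hg
    · exact below (h.le_simple_mul (by omega))
    obtain ⟨y', h1, h2, h3, h4⟩ := ih (hy.simple_mul hi)
      (h.simple_mul_le_simple_mul (by omega)) (fun he => hne (mul_left_cancel he)) (by omega)
    rcases cs.length_simple_mul y' i with hy' | hy'
    · refine ⟨cs.simple i * y', ?_, ?_, by omega, ?_⟩
      · simpa using h1.simple_mul_both (i := i) (by omega)
      · simpa using h2.simple_mul_both (i := i)
          (by simp only [cs.simple_mul_simple_cancel_left]; omega)
      · simpa [mul_assoc] using h4
    · refine below (bruhatLE.trans ?_ h2)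
      simpa using h1.simple_mul_left (i := i) (by omega)

/-! ### The twisted order -/

lemma exists_mul_bruhatLE_iff {x y a b : W} (hx : IsMinRep cs J x) (ha : a ∈ parabolic cs J)
    (hb : b ∈ parabolic cs J) :
    (∃ u ∈ parabolic cs J, bruhatLE cs (x * u) y ∧ bruhatLE cs b (u⁻¹ * a)) ↔
      ∃ a', bruhatLE cs a' a ∧ bruhatLE cs (x * (a' * b⁻¹)) y := by
  constructor
  · rintro ⟨u, hu, hxy, hba⟩
    obtain ⟨ω, hω, hωu⟩ := cs.exists_isReduced u⁻¹
    obtain ⟨ω', hω', rfl⟩ := cs.exists_isReduced a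
    rw [hωu, ← cs.wordProd_append] at hba
    obtain ⟨τ, hτ, rfl⟩ := hba.exists_sublist
    obtain ⟨τ₁, τ₂, rfl, h₁, h₂⟩ := List.sublist_append_iff.1 hτ
    refine ⟨cs.wordProd τ₂, bruhatLE_wordProd hω' h₂, bruhatLE.trans ?_ hxy⟩
    refine hx.mul_bruhatLE_mul hu ?_
    have h := (bruhatLE_wordProd hω h₁).inv
    rw [← hωu, inv_inv] at h
    simpa [cs.wordProd_append] using h
  · rintro ⟨a', ha', hxy⟩
    have hu : a' * b⁻¹ ∈ parabolic cs J := mul_mem (ha'.mem_parabolic ha) (inv_mem hb)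
    obtain ⟨d, hd, hda⟩ := ha'.exists_mul_le_mul (b * a'⁻¹)
    have hd' : bruhatLE cs d⁻¹ (a' * b⁻¹) := by simpa using hd.inv
    refine ⟨d⁻¹, hd'.mem_parabolic hu, (hx.mul_bruhatLE_mul hu hd').trans hxy, ?_⟩
    simpa using hda

lemma twistedLE_iff {v w : W} : twistedLE cs J v w ↔ ∃ a, bruhatLE cs a (parPart cs J v) ∧
    bruhatLE cs (minRep cs J v * (a * (parPart cs J w)⁻¹)) (minRep cs J w) :=
  exists_mul_bruhatLE_iff (isMinRep_minRep v) (parPart_mem v) (parPart_mem w)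

lemma twistedLE_refl (w : W) : twistedLE cs J w w :=
  twistedLE_iff.2 ⟨_, bruhatLE_refl _, by simpa using bruhatLE_refl _⟩

lemma twistedLT.twistedLength_lt {v w : W} (h : twistedLT cs J v w) :
    twistedLength cs J v < twistedLength cs J w := by
  obtain ⟨hle, hne⟩ := h
  obtain ⟨a, ha, hx⟩ := twistedLE_iff.1 hle
  have hu : a * (parPart cs J w)⁻¹ ∈ parabolic cs J :=
    mul_mem (ha.mem_parabolic (parPart_mem v)) (inv_mem (parPart_mem w))
  have hlen := (isMinRep_minRep v).length_mul hu
  have h1 := hx.length_le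
  have h2 := ha.length_le
  have h3 := cs.length_mul_le (a * (parPart cs J w)⁻¹)⁻¹ a
  rw [cs.length_inv, mul_inv_rev, inv_inv, inv_mul_cancel_right] at h3
  unfold twistedLength
  by_contra hlt
  have hxe := hx.eq_of_length_le (by omega)
  have hae := ha.eq_of_length_le (by omega)
  have h4 := (isMinRep_minRep v).eq_one_of_mul (by rw [hxe]; exact isMinRep_minRep w) hu
  rw [h4, mul_one] at hxe
  apply hne
  rw [← minRep_mul_parPart (cs := cs) (J := J) v, ← minRep_mul_parPart (cs := cs) (J := J) w, hxe,
    ← hae, mul_inv_eq_one.1 h4]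

lemma exists_step_of_not_eq {x y a b : W} (hx : IsMinRep cs J x) (hy : IsMinRep cs J y)
    (ha : a ∈ parabolic cs J) (hb : b ∈ parabolic cs J)
    (h : ∃ a', bruhatLE cs a' a ∧ bruhatLE cs (x * (a' * b⁻¹)) y) (hne : ¬(x = y ∧ a = b)) :
    ∃ z c, IsMinRep cs J z ∧ c ∈ parabolic cs J ∧
      (∃ a', bruhatLE cs a' a ∧ bruhatLE cs (x * (a' * c⁻¹)) z) ∧
      (∃ c', bruhatLE cs c' c ∧ bruhatLE cs (z * (c' * b⁻¹)) y) ∧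
      cs.length z + cs.length a = cs.length x + cs.length c + 1 := by
  by_cases hproper : ∃ a', bruhatLE cs a' a ∧ a' ≠ a ∧ bruhatLE cs (x * (a' * b⁻¹)) y
  · obtain ⟨a', ha', hne', hxy⟩ := hproper
    obtain ⟨c, hac, hca, hlen⟩ := ha'.exists_coatom hne'
    exact ⟨x, c, hx, hca.mem_parabolic ha, ⟨c, hca, by simpa using bruhatLE_refl x⟩,
      ⟨a', hac, hxy⟩, by omega⟩
  have hall : ∀ a', bruhatLE cs a' a → bruhatLE cs (x * (a' * b⁻¹)) y → a' = a := by
    intro a' h1 h2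
    by_contra h3
    exact hproper ⟨a', h1, h3, h2⟩
  have hxy : bruhatLE cs (x * (a * b⁻¹)) y := by
    obtain ⟨a', h1, h2⟩ := h
    rwa [hall a' h1 h2] at h2
  obtain ⟨u, hu⟩ : ∃ u, u = a * b⁻¹ := ⟨_, rfl⟩
  have hbu : b = u⁻¹ * a := by rw [hu]; group
  have huJ : u ∈ parabolic cs J := hu ▸ mul_mem ha (inv_mem hb)
  rw [← hu] at hxy
  have hadd : cs.length u + cs.length a ≤ cs.length b := by
    obtain ⟨ω, hω, hωu⟩ := cs.exists_isReduced u⁻¹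
    obtain ⟨ω', hω', hωa⟩ := cs.exists_isReduced a
    obtain ⟨τ, hτ, hred, he⟩ := exists_reduced_sublist cs (ω ++ ω')
    obtain ⟨τ₁, τ₂, rfl, h₁, h₂⟩ := List.sublist_append_iff.1 hτ
    rw [cs.wordProd_append, cs.wordProd_append, ← hωu, ← hωa, ← hbu] at he
    have hle : bruhatLE cs (cs.wordProd τ₁)⁻¹ u := by
      have h := (bruhatLE_wordProd hω h₁).inv
      rwa [← hωu, inv_inv] at h
    have h2 : cs.wordProd τ₂ = a := by
      refine hall _ (by rw [hωa]; exact bruhatLE_wordProd hω' h₂) ?_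
      rw [show cs.wordProd τ₂ * b⁻¹ = (cs.wordProd τ₁)⁻¹ by rw [← he]; group]
      exact (hx.mul_bruhatLE_mul huJ hle).trans hxy
    have h1 : cs.wordProd τ₁ = u⁻¹ := by
      rw [h2, hbu] at he
      exact mul_right_cancel he
    have hl1 := cs.length_wordProd_le τ₁
    have hl2 := cs.length_wordProd_le τ₂
    have hl : cs.length b = τ₁.length + τ₂.length := by
      rw [← he, ← cs.wordProd_append, hred.eq, List.length_append]
    rw [h1, cs.length_inv] at hl1
    rw [h2] at hl2
    omega
  have hxuy : x * u ≠ y := by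
    intro he
    have h1 := hx.eq_one_of_mul (he ▸ hy) huJ
    refine hne ⟨by rw [← he, h1, mul_one], ?_⟩
    rw [hbu, h1, inv_one, one_mul]
  obtain ⟨g, hxg, hgy, hlg, hcoset⟩ := hy.exists_atom hxy hxuy
  obtain ⟨z, u', hz, hu'J, rfl⟩ : ∃ z u', IsMinRep cs J z ∧ u' ∈ parabolic cs J ∧ g = z * u' :=
    ⟨_, _, isMinRep_minRep g, parPart_mem g, (minRep_mul_parPart g).symm⟩
  have hlzu := hz.length_mul hu'J
  have hlxu := hx.length_mul huJ
  have hpJ : u * u'⁻¹ ∈ parabolic cs J := mul_mem huJ (inv_mem hu'J)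
  have hlxp := hx.length_mul hpJ
  obtain ⟨hpz, hlp⟩ : bruhatLE cs (x * (u * u'⁻¹)) z ∧
      cs.length (x * (u * u'⁻¹)) + 1 = cs.length z := by
    obtain ⟨ω, hω, rfl⟩ := cs.exists_isReduced z
    obtain ⟨ω', hω', rfl⟩ := cs.exists_isReduced u'
    rw [← cs.wordProd_append] at hxg
    obtain ⟨τ, hτ, hτx⟩ := hxg.exists_sublist
    obtain ⟨τ₁, τ₂, rfl, h₁, h₂⟩ := List.sublist_append_iff.1 hτ
    have hlτ := cs.length_wordProd_le (τ₁ ++ τ₂)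
    rw [hτx, List.length_append] at hlτ
    rw [cs.wordProd_append] at hτx
    have hne₁ : τ₁.length ≠ ω.length := by
      intro heq
      obtain rfl := h₁.eq_of_length heq
      apply hcoset
      rw [← hτx, mul_inv_rev, mul_assoc, inv_mul_cancel_left]
      exact mul_mem (inv_mem ((bruhatLE_wordProd hω' h₂).mem_parabolic hu'J)) hu'J
    have hle₁ := h₁.length_le
    have hω₁ := hω.eq
    have hω₂ := hω'.eq
    obtain rfl := h₂.eq_of_length_le (by omega)
    have hxp : x * (u * (cs.wordProd τ₂)⁻¹) = cs.wordProd τ₁ := by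
      rw [← mul_assoc, ← hτx, mul_inv_cancel_right]
    have hl₁ := cs.length_wordProd_le τ₁
    have hl₁₂ := cs.length_mul_le (cs.wordProd τ₁) (cs.wordProd τ₂)
    rw [hτx] at hl₁₂
    rw [hxp]
    exact ⟨bruhatLE_wordProd hω h₁, by omega⟩
  refine ⟨z, u' * b, hz, mul_mem hu'J hb, ⟨a, bruhatLE_refl a, ?_⟩, ⟨u' * b, bruhatLE_refl _, ?_⟩,
    ?_⟩
  · rwa [mul_inv_rev, ← mul_assoc a, ← hu]
  · rwa [mul_inv_cancel_right]
  · have h1 := cs.length_mul_le u'⁻¹ (u' * b)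
    rw [inv_mul_cancel_left, cs.length_inv] at h1
    have h2 := cs.length_mul_le (u * u'⁻¹)⁻¹ a
    rw [cs.length_inv, mul_inv_rev, inv_inv, mul_assoc, ← hbu] at h2
    omega

lemma twistedLT.exists_step {v w : W} (h : twistedLT cs J v w) :
    ∃ z, twistedLE cs J v z ∧ twistedLE cs J z w ∧
      twistedLength cs J z = twistedLength cs J v + 1 := by
  obtain ⟨z, c, hz, hc, h1, h2, h3⟩ := exists_step_of_not_eq (isMinRep_minRep v)
    (isMinRep_minRep w) (parPart_mem v) (parPart_mem w) (twistedLE_iff.1 h.1) (by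
      rintro ⟨hm, hp⟩
      apply h.2
      rw [← minRep_mul_parPart (cs := cs) (J := J) v, hm, hp, minRep_mul_parPart])
  refine ⟨z * c, twistedLE_iff.2 ?_, twistedLE_iff.2 ?_, ?_⟩
  · rwa [hz.minRep_mul hc, hz.parPart_mul hc]
  · rwa [hz.minRep_mul hc, hz.parPart_mul hc]
  · rw [twistedLength, twistedLength, hz.minRep_mul hc, hz.parPart_mul hc]
    omega

lemma twistedCovBy.twistedLength_eq {v w : W} (h : twistedCovBy cs J v w) :
    twistedLength cs J w = twistedLength cs J v + 1 := by
  obtain ⟨z, hvz, hzw, hlen⟩ := h.1.exists_step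
  by_cases hz : z = w
  · rwa [← hz]
  · refine absurd ⟨z, ⟨hvz, ?_⟩, hzw, hz⟩ h.2
    rintro rfl
    omega

lemma twistedCovBy_of_twistedLength_eq {v w : W} (h : twistedLE cs J v w)
    (hlen : twistedLength cs J w = twistedLength cs J v + 1) : twistedCovBy cs J v w := by
  refine ⟨⟨h, ?_⟩, ?_⟩
  · rintro rfl
    omega
  · rintro ⟨z, hvz, hzw⟩
    have := hvz.twistedLength_lt
    have := hzw.twistedLength_lt
    omega

lemma exists_maximal_chain {v w : W} (h : twistedLE cs J v w) :
    ∃ c : List W, IsChainFrom (twistedCovBy cs J) c v w := by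
  induction hn : (twistedLength cs J w - twistedLength cs J v).toNat generalizing v with
  | zero =>
    by_cases hvw : v = w
    · subst hvw
      exact ⟨[v], rfl, rfl, List.isChain_singleton v⟩
    · have := twistedLT.twistedLength_lt ⟨h, hvw⟩
      omega
  | succ n ih =>
    obtain ⟨z, hvz, hzw, hlen⟩ := twistedLT.exists_step (cs := cs) (J := J) (v := v) (w := w)
      ⟨h, by rintro rfl; simp at hn⟩
    obtain ⟨c, hhead, hlast, hchain⟩ := ih hzw (by omega)
    cases c with
    | nil => simp at hhead
    | cons z' c =>
      obtain rfl : z' = z := by simpa using hhead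
      exact ⟨v :: z' :: c, rfl, by simpa using hlast,
        List.isChain_cons_cons.2 ⟨twistedCovBy_of_twistedLength_eq hvz hlen, hchain⟩⟩

lemma length_of_maximal_chain {v w : W} {c : List W} (h : IsChainFrom (twistedCovBy cs J) c v w) :
    (c.length : ℤ) - 1 = twistedLength cs J w - twistedLength cs J v := by
  obtain ⟨hhead, hlast, hchain⟩ := h
  induction c generalizing v with
  | nil => simp at hhead
  | cons v' c ih =>
    obtain rfl : v' = v := by simpa using hhead
    cases c with
    | nil =>
      obtain rfl : v' = w := by simpa using hlast
      simp
    | cons z c =>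
      obtain ⟨hcov, hchain⟩ := List.isChain_cons_cons.1 hchain
      have := ih (v := z) rfl (by simpa using hlast) hchain
      have := hcov.twistedLength_eq
      simp only [List.length_cons] at *
      push_cast at *
      omega

variable (cs)

/-- Let `J ⊆ I` and `v ≤^J w`. Then the interval `[v, w]` of
`(W, ≤^J)` is graded: it has minimum `v` and maximum `w` (in particular `v` and
`w` belong to it, by reflexivity), a maximal chain from `v` to `w` exists, and
every maximal chain from `v` to `w` has the same length, namely
`ℓ^J(w) - ℓ^J(v)`. -/
theorem twisted_interval_graded (J : Set B) (v w : W) (hvw : twistedLE cs J v w) :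
    (twistedLE cs J v v ∧ twistedLE cs J w w) ∧
    (∃ c : List W, IsChainFrom (twistedCovBy cs J) c v w) ∧
    (∀ c : List W, IsChainFrom (twistedCovBy cs J) c v w →
      (c.length : ℤ) - 1 = twistedLength cs J w - twistedLength cs J v) := by
  exact ⟨⟨twistedLE_refl v, twistedLE_refl w⟩, exists_maximal_chain hvw,
    fun _ => length_of_maximal_chain⟩

end TwistedTP
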